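/- Let 0 < α, β < 1 and let X_α, X_β be independent with Lamperti densities ρ_α, ρ_β respectively, where ρ_γ(x) = (sin πγ/π) x^{γ−1}/(x^{2γ}+2x^γ cos πγ+1). Then X_α · (X_β)^{1/α} has the same distribution as X_{αβ}, i.e., its density is ρ_{αβ}. -/

import Mathlib

open Real MeasureTheory Set ProbabilityTheory

/-- The Lamperti density of index `γ`. -/
noncomputable def lampertiDensity (γ x : ℝ) : ℝ :=
  Set.indicator (Ioi (0:ℝ))
    (fun x => (Real.sin (π * γ) / π) * x ^ (γ - 1) /
      (x ^ (2 * γ) + 2 * x ^ γ * Real.cos (π * γ) + 1)) x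

noncomputable def lampH (β : ℝ) (ζ : ℂ) : ℂ :=
  Complex.exp (β * ζ) / (1 + Complex.exp (β * ζ))

noncomputable def lampG (β : ℝ) (l ζ : ℂ) : ℂ :=
  -Complex.exp l * dslope (lampH β) l ζ / dslope Complex.exp l ζ

lemma one_add_exp_ne {β : ℝ} {ζ : ℂ} (h1 : -π < β * ζ.im)
    (h2 : β * ζ.im < π) : 1 + Complex.exp (β * ζ) ≠ 0 := by
  intro h
  have h3 : Complex.exp (β * ζ) = Complex.exp (π * Complex.I) := by
    rw [Complex.exp_pi_mul_I]; linear_combination h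
  have h4 := congrArg Complex.log h3
  rw [Complex.log_exp (by simpa using h1) (by simpa using h2.le),
    Complex.log_exp (by simp; linarith [Real.pi_pos]) (by simp)] at h4
  have := congrArg Complex.im h4
  simp at this
  linarith

lemma lampG_eq {β : ℝ} {l ζ : ℂ} (h : ζ ≠ l) :
    lampG β l ζ = (lampH β ζ - lampH β l) * (Complex.exp l / (Complex.exp l - Complex.exp ζ)) := by
  have h0 : ζ - l ≠ 0 := sub_ne_zero.mpr h
  unfold lampG
  rw [dslope_of_ne _ h, dslope_of_ne _ h, slope_def_field, slope_def_field]
  by_cases h1 : Complex.exp ζ - Complex.exp l = 0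
  · have h2 : Complex.exp l - Complex.exp ζ = 0 := by linear_combination -h1
    simp [h1, h2]
  · have h2 : Complex.exp l - Complex.exp ζ ≠ 0 := fun h3 => h1 (by linear_combination -h3)
    field_simp
    ring

lemma dslope_exp_ne {l ζ : ℂ} (h : |ζ.im - l.im| < 2 * π) : dslope Complex.exp l ζ ≠ 0 := by
  by_cases h1 : ζ = l
  · subst h1
    simp [Complex.exp_ne_zero]
  · rw [dslope_of_ne _ h1, slope_def_field]
    refine div_ne_zero (sub_ne_zero.mpr ?_) (sub_ne_zero.mpr h1)
    intro h2
    obtain ⟨n, hn⟩ := Complex.exp_eq_exp_iff_exists_int.mp h2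
    have h3 : ζ.im - l.im = n * (2 * π) := by rw [hn]; simp
    rw [h3, abs_mul, abs_of_pos Real.two_pi_pos] at h
    have h4 : |(n : ℝ)| < 1 := by
      by_contra h5
      push Not at h5
      nlinarith [Real.two_pi_pos]
    have h5 : n = 0 := by
      have : |n| < 1 := by exact_mod_cast h4
      exact Int.abs_lt_one_iff.mp this
    subst h5
    simp at hn
    exact h1 hn

def lampStrip (β : ℝ) (l : ℂ) : Set ℂ :=
  {ζ | -π < β * ζ.im ∧ β * ζ.im < π ∧ |ζ.im - l.im| < 2 * π}

lemma isOpen_lampStrip (β : ℝ) (l : ℂ) : IsOpen (lampStrip β l) := by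
  unfold lampStrip
  have h1 : IsOpen {ζ : ℂ | -π < β * ζ.im} := isOpen_lt (by fun_prop) (by fun_prop)
  have h2 : IsOpen {ζ : ℂ | β * ζ.im < π} := isOpen_lt (by fun_prop) (by fun_prop)
  have h3 : IsOpen {ζ : ℂ | |ζ.im - l.im| < 2 * π} := isOpen_lt (by fun_prop) (by fun_prop)
  exact h1.inter (h2.inter h3)

lemma mem_lampStrip {β : ℝ} (hβ0 : 0 < β) (hβ1 : β < 1) {l : ℂ} (hl0 : 0 < l.im) (hl1 : l.im < π)
    {ζ : ℂ} (h1 : -π ≤ ζ.im) (h2 : ζ.im ≤ π) : ζ ∈ lampStrip β l := by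
  have := Real.pi_pos
  refine ⟨by nlinarith, by nlinarith, ?_⟩
  rw [abs_lt]; constructor <;> linarith

lemma lampG_diff {β : ℝ} (hβ0 : 0 < β) (hβ1 : β < 1) {l : ℂ} (hl0 : 0 < l.im) (hl1 : l.im < π) :
    DifferentiableOn ℂ (lampG β l) (lampStrip β l) := by
  have hl : l ∈ lampStrip β l := mem_lampStrip hβ0 hβ1 hl0 hl1 (by linarith) hl1.le
  have hn : lampStrip β l ∈ nhds l := (isOpen_lampStrip β l).mem_nhds hl
  unfold lampG
  refine DifferentiableOn.div (DifferentiableOn.const_mul ?_ _) ?_ ?_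
  · rw [Complex.differentiableOn_dslope hn]
    unfold lampH
    refine DifferentiableOn.div (by fun_prop) (by fun_prop) ?_
    intro ζ hζ
    exact one_add_exp_ne hζ.1 hζ.2.1
  · rw [Complex.differentiableOn_dslope hn]
    fun_prop
  · intro ζ hζ
    exact dslope_exp_ne hζ.2.2

lemma lampG_rect {β : ℝ} (hβ0 : 0 < β) (hβ1 : β < 1) {l : ℂ} (hl0 : 0 < l.im) (hl1 : l.im < π) (R : ℝ) :
    (∫ x in (-R)..R, (lampG β l (x + π * Complex.I) - lampG β l (x - π * Complex.I)))
      = Complex.I * ((∫ y in (-π)..π, lampG β l (R + y * Complex.I))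
        - ∫ y in (-π)..π, lampG β l (-R + y * Complex.I)) := by
  have hp := Real.pi_pos
  have key := Complex.integral_boundary_rect_eq_zero_of_differentiableOn (lampG β l)
    (-R - π * Complex.I) (R + π * Complex.I) ((lampG_diff hβ0 hβ1 hl0 hl1).mono (by
      intro ζ hζ
      rw [Complex.mem_reProdIm] at hζ
      have h2 := hζ.2
      simp at h2
      rw [uIcc_of_le (by linarith)] at h2
      exact mem_lampStrip hβ0 hβ1 hl0 hl1 h2.1 h2.2))
  have hc := (lampG_diff hβ0 hβ1 hl0 hl1).continuousOn
  rw [intervalIntegral.integral_sub]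
  · simp [← sub_eq_add_neg] at key
    linear_combination -key
  · apply ContinuousOn.intervalIntegrable
    refine hc.comp (by fun_prop) ?_
    intro x _
    exact mem_lampStrip hβ0 hβ1 hl0 hl1 (by simp; linarith) (by simp)
  · apply ContinuousOn.intervalIntegrable
    refine hc.comp (by fun_prop) ?_
    intro x _
    exact mem_lampStrip hβ0 hβ1 hl0 hl1 (by simp) (by simp; linarith)

lemma lampG_right {β : ℝ} (hβ0 : 0 < β) {l : ℂ} :
    Filter.Tendsto (fun R : ℝ => ∫ y in (-π)..π, lampG β l (R + y * Complex.I))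
      Filter.atTop (nhds 0) := by
  have hexp : Filter.Tendsto (fun R : ℝ => Real.exp R) Filter.atTop Filter.atTop :=
    Real.tendsto_exp_atTop
  have hexpb : Filter.Tendsto (fun R : ℝ => Real.exp (β * R)) Filter.atTop Filter.atTop :=
    Real.tendsto_exp_atTop.comp (Filter.tendsto_id.const_mul_atTop hβ0)
  set W := ‖Complex.exp l‖ with hW
  have hlim : Filter.Tendsto (fun R : ℝ => (2 + ‖lampH β l‖) * (W / (Real.exp R - W)) * |π - -π|)
      Filter.atTop (nhds 0) := by
    have h1 : Filter.Tendsto (fun R : ℝ => W / (Real.exp R - W)) Filter.atTop (nhds 0) :=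
      Filter.Tendsto.const_div_atTop
        (Filter.tendsto_atTop_add_const_right _ (-W) hexp) W
    simpa using (h1.const_mul (2 + ‖lampH β l‖)).mul_const |π - -π|
  refine squeeze_zero_norm' ?_ hlim
  filter_upwards [hexp.eventually_gt_atTop W, hexpb.eventually_ge_atTop 2,
    Filter.eventually_gt_atTop l.re] with R h1 h2 h3
  apply intervalIntegral.norm_integral_le_of_norm_le_const
  intro y _
  set ζ : ℂ := R + y * Complex.I with hζ
  have hre : ζ.re = R := by simp [hζ]
  have hne : ζ ≠ l := by rintro h; rw [← h, hre] at h3; exact lt_irrefl _ h3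
  rw [lampG_eq hne, norm_mul, norm_div]
  have hH : ‖lampH β ζ‖ ≤ 2 := by
    unfold lampH
    have ha : ‖Complex.exp (β * ζ)‖ = Real.exp (β * R) := by
      rw [Complex.norm_exp]; simp [hre]
    set a := Complex.exp (β * ζ)
    have hb : ‖a‖ - 1 ≤ ‖1 + a‖ := by
      have := norm_sub_norm_le a (-1)
      simp only [norm_neg, norm_one, sub_neg_eq_add] at this
      rwa [add_comm 1 a]
    rw [norm_div, div_le_iff₀ (by linarith)]
    linarith
  have hk : Real.exp R - W ≤ ‖Complex.exp l - Complex.exp ζ‖ := by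
    have := norm_sub_norm_le (Complex.exp ζ) (Complex.exp l)
    rw [norm_sub_rev, Complex.norm_exp ζ, hre] at this
    exact this
  have h4 : 0 < Real.exp R - W := by linarith
  gcongr
  exact (norm_sub_le _ _).trans (by linarith)

lemma lampG_left {β : ℝ} (hβ0 : 0 < β) (hβ1 : β < 1) {l : ℂ} (hl0 : 0 < l.im) (hl1 : l.im < π) :
    Filter.Tendsto (fun R : ℝ => ∫ y in (-π)..π, lampG β l (-R + y * Complex.I))
      Filter.atTop (nhds (-(2 * π * lampH β l))) := by
  have hexp : Filter.Tendsto (fun R : ℝ => Real.exp (-R)) Filter.atTop (nhds 0) :=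
    Real.tendsto_exp_neg_atTop_nhds_zero
  have hexpb : Filter.Tendsto (fun R : ℝ => Real.exp (-(β * R))) Filter.atTop (nhds 0) :=
    Real.tendsto_exp_neg_atTop_nhds_zero.comp (Filter.tendsto_id.const_mul_atTop hβ0)
  set W := ‖Complex.exp l‖ with hW
  have hWpos : 0 < W := norm_pos_iff.mpr (Complex.exp_ne_zero _)
  have hlim : Filter.Tendsto (fun R : ℝ => (2 * Real.exp (-(β * R)) * 2
      + ‖lampH β l‖ * (Real.exp (-R) / (W / 2))) * |π - -π|) Filter.atTop (nhds 0) := by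
    have := (((hexpb.const_mul 2).mul_const 2).add
      ((hexp.div_const (W / 2)).const_mul ‖lampH β l‖)).mul_const |π - -π|
    simpa using this
  have hint : ∀ R : ℝ, (∫ y in (-π)..π, lampG β l (-R + y * Complex.I)) - (-(2 * π * lampH β l))
      = ∫ y in (-π)..π, (lampG β l (-R + y * Complex.I) + lampH β l) := by
    intro R
    rw [intervalIntegral.integral_add]
    · simp; left; ring
    · apply ContinuousOn.intervalIntegrable
      refine (lampG_diff hβ0 hβ1 hl0 hl1).continuousOn.comp (by fun_prop) ?_
      intro x hx
      rw [uIcc_of_le (by linarith [Real.pi_pos])] at hx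
      exact mem_lampStrip hβ0 hβ1 hl0 hl1 (by simpa using hx.1) (by simpa using hx.2)
    · simp
  rw [tendsto_iff_norm_sub_tendsto_zero]
  simp_rw [hint]
  refine squeeze_zero' (Filter.Eventually.of_forall fun _ => norm_nonneg _) ?_ hlim
  filter_upwards [hexp.eventually_lt_const (show 0 < W / 2 by linarith),
    hexpb.eventually_lt_const (show (0:ℝ) < 1 / 2 by norm_num),
    Filter.eventually_gt_atTop (-l.re)] with R h1 h2 h3
  apply intervalIntegral.norm_integral_le_of_norm_le_const
  intro y _
  set ζ : ℂ := -R + y * Complex.I with hζ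
  have hre : ζ.re = -R := by simp [hζ]
  have hne : ζ ≠ l := by rintro h; rw [← h, hre] at h3; linarith
  have hH : ‖lampH β ζ‖ ≤ 2 * Real.exp (-(β * R)) := by
    unfold lampH
    have ha : ‖Complex.exp (β * ζ)‖ = Real.exp (-(β * R)) := by
      rw [Complex.norm_exp]; simp [hre]
    set a := Complex.exp (β * ζ)
    have hb : 1 - ‖a‖ ≤ ‖1 + a‖ := by
      have := norm_sub_norm_le 1 (-a)
      simpa only [norm_neg, norm_one, sub_neg_eq_add] using this
    rw [norm_div, div_le_iff₀ (by linarith), ← ha]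
    nlinarith [norm_nonneg a]
  have hez : ‖Complex.exp ζ‖ = Real.exp (-R) := by rw [Complex.norm_exp, hre]
  have hk : W / 2 ≤ ‖Complex.exp l - Complex.exp ζ‖ := by
    have := norm_sub_norm_le (Complex.exp l) (Complex.exp ζ)
    rw [hez] at this
    linarith
  have hk0 : Complex.exp l - Complex.exp ζ ≠ 0 := norm_pos_iff.mp (by linarith)
  have heq : lampG β l ζ + lampH β l = lampH β ζ * (Complex.exp l / (Complex.exp l - Complex.exp ζ))
      - lampH β l * (Complex.exp ζ / (Complex.exp l - Complex.exp ζ)) := by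
    rw [lampG_eq hne]
    field_simp
    ring
  rw [heq]
  refine (norm_sub_le _ _).trans ?_
  rw [norm_mul, norm_mul, norm_div, norm_div, hez]
  have h5 : ‖Complex.exp l‖ / ‖Complex.exp l - Complex.exp ζ‖ ≤ 2 := by
    rw [div_le_iff₀ (by linarith)]
    linarith
  gcongr

lemma lamp_den_pos {β r : ℝ} (hβ0 : 0 < β) (hβ1 : β < 1) :
    0 < r ^ 2 + 2 * r * Real.cos (π * β) + 1 := by
  have h1 := Real.sin_sq_add_cos_sq (π * β)
  have h2 : 0 < Real.sin (π * β) :=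
    Real.sin_pos_of_pos_of_lt_pi (by have := Real.pi_pos; positivity) (by nlinarith [Real.pi_pos])
  nlinarith [sq_nonneg (r + Real.cos (π * β)), sq_nonneg (r + Real.cos (π * β)), mul_pos h2 h2]

lemma lamp_exp {β : ℝ} (u : ℝ) : Real.exp u * lampertiDensity β (Real.exp u) =
    Real.sin (π * β) / π * Real.exp (β * u) /
      (Real.exp (β * u) ^ 2 + 2 * Real.exp (β * u) * Real.cos (π * β) + 1) := by
  unfold lampertiDensity
  rw [Set.indicator_of_mem (by exact Real.exp_pos u)]
  rw [← Real.exp_mul, ← Real.exp_mul, ← Real.exp_mul, ← Real.exp_nat_mul]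
  have : Real.exp u * Real.exp (u * (β - 1)) = Real.exp (β * u) := by
    rw [← Real.exp_add]; ring_nf
  rw [show u * (2 * β) = ((2:ℕ):ℝ) * (β * u) by push_cast; ring, mul_comm u β, ← this]
  ring

lemma lampH_top {β : ℝ} (u s : ℝ) (hs : s = 1 ∨ s = -1) : Complex.exp (β * (u + s * (π * Complex.I))) =
    Real.exp (β * u) * (Real.cos (π * β) + s * (Real.sin (π * β) * Complex.I)) := by
  rw [mul_add, Complex.exp_add]
  have : (β : ℂ) * (s * (π * Complex.I)) = ((s * (π * β) : ℝ) : ℂ) * Complex.I := by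
    push_cast; ring
  rw [this, Complex.exp_mul_I, ← Complex.ofReal_cos, ← Complex.ofReal_sin]
  rcases hs with rfl | rfl
  · push_cast; simp
  · push_cast; simp

lemma lampH_diff_eq {β : ℝ} (hβ0 : 0 < β) (hβ1 : β < 1) (u : ℝ) :
    lampH β (u + π * Complex.I) - lampH β (u - π * Complex.I) =
      2 * π * Complex.I * ((Real.exp u * lampertiDensity β (Real.exp u) : ℝ) : ℂ) := by
  have hp := Real.pi_pos
  rw [lamp_exp]
  have hd := lamp_den_pos (r := Real.exp (β * u)) hβ0 hβ1
  have e1 := lampH_top (β := β) u 1 (Or.inl rfl)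
  have e2 := lampH_top (β := β) u (-1) (Or.inr rfl)
  have n1 : 1 + Complex.exp (β * (u + π * Complex.I)) ≠ 0 :=
    one_add_exp_ne (by simp; nlinarith) (by simp; nlinarith)
  have n2 : 1 + Complex.exp (β * (u - π * Complex.I)) ≠ 0 :=
    one_add_exp_ne (by simp; nlinarith) (by simp; nlinarith)
  simp only [Complex.ofReal_one, one_mul, Complex.ofReal_neg, neg_mul, ← sub_eq_add_neg] at e1 e2
  unfold lampH
  rw [e1] at n1 ⊢
  rw [e2] at n2 ⊢
  have hsc : ((Real.cos (π * β) : ℝ) : ℂ) ^ 2 = 1 - ((Real.sin (π * β) : ℝ) : ℂ) ^ 2 := by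
    have := Real.sin_sq_add_cos_sq (π * β)
    rw [← Complex.ofReal_pow, ← Complex.ofReal_pow, ← Complex.ofReal_one, ← Complex.ofReal_sub]
    congr 1; linarith
  generalize Real.exp (β * u) = r at *
  generalize Real.cos (π * β) = c at *
  generalize Real.sin (π * β) = s at *
  have hd' : (r:ℂ) ^ 2 + 2 * r * c + 1 ≠ 0 := by
    have := hd.ne'
    exact_mod_cast this
  have hpc : (π : ℂ) ≠ 0 := by exact_mod_cast hp.ne'
  have hprod : (1 + (r:ℂ) * (c + s * Complex.I)) * (1 + (r:ℂ) * (c - s * Complex.I))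
      = (r:ℂ) ^ 2 + 2 * r * c + 1 := by
    linear_combination (r:ℂ)^2 * hsc - (r:ℂ)^2 * (s:ℂ)^2 * Complex.I_sq
  rw [div_sub_div _ _ n1 n2, hprod]
  push_cast
  field_simp
  ring

lemma integral_lamp_u {β : ℝ} (hβ0 : 0 < β) (hβ1 : β < 1) {l : ℂ} (hl0 : 0 < l.im) (hl1 : l.im < π)
    (hI : Integrable (fun u : ℝ => Real.exp u * lampertiDensity β (Real.exp u))) :
    Integrable (fun u : ℝ => ((Real.exp u * lampertiDensity β (Real.exp u) : ℝ) : ℂ) *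
      (Complex.exp l / (Real.exp u + Complex.exp l))) ∧
    ∫ u : ℝ, ((Real.exp u * lampertiDensity β (Real.exp u) : ℝ) : ℂ) *
      (Complex.exp l / (Real.exp u + Complex.exp l)) = lampH β l := by
  have hp := Real.pi_pos
  have him : 0 < (Complex.exp l).im := by
    rw [Complex.exp_im]
    exact mul_pos (Real.exp_pos _) (Real.sin_pos_of_pos_of_lt_pi hl0 hl1)
  have hb : ∀ u : ℝ, (Complex.exp l).im ≤ ‖(Real.exp u + Complex.exp l : ℂ)‖ := by
    intro u
    have := Complex.abs_im_le_norm (Real.exp u + Complex.exp l : ℂ)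
    simp only [Complex.add_im, Complex.ofReal_im, zero_add] at this
    exact (le_abs_self _).trans this
  have hn : ∀ u : ℝ, (Real.exp u + Complex.exp l : ℂ) ≠ 0 := fun u =>
    norm_pos_iff.mp (him.trans_le (hb u))
  have hint : Integrable (fun u : ℝ => ((Real.exp u * lampertiDensity β (Real.exp u) : ℝ) : ℂ) *
      (Complex.exp l / (Real.exp u + Complex.exp l))) := by
    refine hI.ofReal.mul_bdd (c := ‖Complex.exp l‖ / (Complex.exp l).im) ?_ ?_
    · apply Continuous.aestronglyMeasurable
      exact continuous_const.div (by fun_prop) hn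
    · refine Filter.Eventually.of_forall fun u => ?_
      rw [norm_div]
      have := hb u
      gcongr
  refine ⟨hint, ?_⟩
  have hG : ∀ u : ℝ, lampG β l (u + π * Complex.I) - lampG β l (u - π * Complex.I) =
      2 * π * Complex.I * (((Real.exp u * lampertiDensity β (Real.exp u) : ℝ) : ℂ) *
      (Complex.exp l / (Real.exp u + Complex.exp l))) := by
    intro u
    have h1 : (u + π * Complex.I : ℂ) ≠ l := by
      intro h; rw [← h] at hl1; simp at hl1
    have h2 : (u - π * Complex.I : ℂ) ≠ l := by
      intro h; rw [← h] at hl0; simp at hl0; linarith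
    rw [lampG_eq h1, lampG_eq h2, Complex.exp_add, Complex.exp_sub, Complex.exp_pi_mul_I,
      ← mul_assoc (2 * π * Complex.I), ← lampH_diff_eq hβ0 hβ1]
    push_cast
    have e1 : Complex.exp l - Complex.exp u * -1 = Complex.exp u + Complex.exp l := by ring
    have e2 : Complex.exp l - Complex.exp u / -1 = Complex.exp u + Complex.exp l := by ring
    rw [e1, e2]
    ring
  have t1 : Filter.Tendsto (fun R : ℝ => ∫ x in (-R)..R,
      (lampG β l (x + π * Complex.I) - lampG β l (x - π * Complex.I))) Filter.atTop
      (nhds (Complex.I * (0 - -(2 * π * lampH β l)))) := by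
    simp_rw [lampG_rect hβ0 hβ1 hl0 hl1]
    exact ((lampG_right hβ0).sub (lampG_left hβ0 hβ1 hl0 hl1)).const_mul _
  simp_rw [hG] at t1
  have t2 := intervalIntegral_tendsto_integral (hint.const_mul (2 * π * Complex.I))
    Filter.tendsto_neg_atTop_atBot Filter.tendsto_id
  have t3 := tendsto_nhds_unique t2 t1
  rw [integral_const_mul] at t3
  have hc : (2 * π * Complex.I : ℂ) ≠ 0 := Complex.two_pi_I_ne_zero
  apply mul_left_cancel₀ hc
  rw [t3]; ring

lemma exp_image_univ : Real.exp '' univ = Ioi 0 := by rw [image_univ, Real.range_exp]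

lemma integral_lamp_y {β : ℝ} (hβ0 : 0 < β) (hβ1 : β < 1) {l : ℂ} (hl0 : 0 < l.im) (hl1 : l.im < π)
    (hI : IntegrableOn (lampertiDensity β) (Ioi 0)) :
    IntegrableOn (fun y : ℝ => ((lampertiDensity β y : ℝ) : ℂ) *
      (Complex.exp l / (y + Complex.exp l))) (Ioi 0) ∧
    ∫ y in Ioi (0:ℝ), ((lampertiDensity β y : ℝ) : ℂ) *
      (Complex.exp l / (y + Complex.exp l)) = lampH β l := by
  have hd : ∀ x ∈ (univ : Set ℝ), HasDerivWithinAt Real.exp (Real.exp x) univ x :=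
    fun x _ => (Real.hasDerivAt_exp x).hasDerivWithinAt
  have hinj : InjOn Real.exp univ := Real.exp_injective.injOn
  rw [← exp_image_univ] at hI ⊢
  rw [integrableOn_image_iff_integrableOn_abs_deriv_smul MeasurableSet.univ hd hinj,
    integrableOn_univ] at hI ⊢
  rw [integral_image_eq_integral_abs_deriv_smul MeasurableSet.univ hd hinj, setIntegral_univ]
  simp only [abs_of_pos (Real.exp_pos _), smul_eq_mul] at hI ⊢
  have := integral_lamp_u hβ0 hβ1 hl0 hl1 hI
  have e : (fun u : ℝ => ((Real.exp u * lampertiDensity β (Real.exp u) : ℝ) : ℂ) *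
      (Complex.exp l / (Real.exp u + Complex.exp l))) = fun u : ℝ =>
      Real.exp u • (((lampertiDensity β (Real.exp u) : ℝ) : ℂ) *
      (Complex.exp l / (Real.exp u + Complex.exp l))) := by
    funext u
    rw [Complex.real_smul]; push_cast; ring
  rw [e] at this
  exact this

lemma lamp_of_pos {γ x : ℝ} (hx : 0 < x) : lampertiDensity γ x =
    Real.sin (π * γ) / π * (x ^ γ / x) / ((x ^ γ) ^ 2 + 2 * x ^ γ * Real.cos (π * γ) + 1) := by
  unfold lampertiDensity
  rw [Set.indicator_of_mem (by exact hx), Real.rpow_sub_one hx.ne', mul_comm 2 γ,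
    Real.rpow_mul hx.le, Real.rpow_two]

lemma lamp_nonneg {γ : ℝ} (h0 : 0 < γ) (h1 : γ < 1) (x : ℝ) : 0 ≤ lampertiDensity γ x := by
  by_cases hx : 0 < x
  · rw [lamp_of_pos hx]
    have h2 : 0 < Real.sin (π * γ) :=
      Real.sin_pos_of_pos_of_lt_pi (by have := Real.pi_pos; positivity) (by nlinarith [Real.pi_pos])
    have := Real.pi_pos
    have := lamp_den_pos (r := x ^ γ) h0 h1
    positivity
  · unfold lampertiDensity
    rw [Set.indicator_of_notMem (by exact hx)]

lemma lamp_zero {γ x : ℝ} (hx : ¬ 0 < x) : lampertiDensity γ x = 0 := by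
  unfold lampertiDensity
  rw [Set.indicator_of_notMem (by exact hx)]

lemma lamp_meas (γ : ℝ) : Measurable (lampertiDensity γ) := by
  unfold lampertiDensity
  refine Measurable.indicator ?_ measurableSet_Ioi
  fun_prop

lemma im_frac (t r c s : ℝ) (h : s ^ 2 + c ^ 2 = 1) :
    ((r * (c + s * Complex.I) : ℂ) / (t + r * (c + s * Complex.I))).im
      = t * r * s / (t ^ 2 + 2 * t * r * c + r ^ 2) := by
  have hn : Complex.normSq (t + r * (c + s * Complex.I)) = t ^ 2 + 2 * t * r * c + r ^ 2 := by
    rw [Complex.normSq_apply]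
    simp
    linear_combination r ^ 2 * h
  rw [Complex.div_im, hn]
  simp
  ring

lemma exp_mk {z : ℝ} (hz : 0 < z) (γ : ℝ) :
    Complex.exp (((γ * Real.log z : ℝ) : ℂ) + ((π * γ : ℝ) : ℂ) * Complex.I) =
      ((z ^ γ : ℝ) : ℂ) * ((Real.cos (π * γ) : ℝ) + (Real.sin (π * γ) : ℝ) * Complex.I) := by
  rw [Complex.exp_add, Complex.exp_mul_I, ← Complex.ofReal_exp, ← Complex.ofReal_cos,
    ← Complex.ofReal_sin, Real.rpow_def_of_pos hz, mul_comm γ]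

lemma lamp_eq_im {α β z : ℝ} (hz : 0 < z) : lampertiDensity (α * β) z =
    1 / (π * z) * (lampH β (((α * Real.log z : ℝ) : ℂ) + ((π * α : ℝ) : ℂ) * Complex.I)).im := by
  unfold lampH
  have e : (β : ℂ) * (((α * Real.log z : ℝ) : ℂ) + ((π * α : ℝ) : ℂ) * Complex.I) =
    ((((α * β) * Real.log z : ℝ) : ℂ) + ((π * (α * β) : ℝ) : ℂ) * Complex.I) := by
    push_cast; ring
  have := im_frac 1 (z ^ (α * β)) _ _ (Real.sin_sq_add_cos_sq (π * (α * β)))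
  rw [Complex.ofReal_one] at this
  rw [e, exp_mk hz, this, lamp_of_pos hz]
  have e2 : ((z ^ (α * β)) ^ 2 + 2 * z ^ (α * β) * Real.cos (π * (α * β)) + 1) =
    (1 ^ 2 + 2 * 1 * z ^ (α * β) * Real.cos (π * (α * β)) + (z ^ (α * β)) ^ 2) := by ring
  rw [e2]
  have := Real.pi_pos
  field_simp

lemma lamp_kernel {α z y : ℝ} (hα0 : 0 < α) (hα1 : α < 1) (hz : 0 < z) (hy : 0 < y) :
    (y ^ (1 / α))⁻¹ * lampertiDensity α (z * (y ^ (1 / α))⁻¹) =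
    1 / (π * z) * (Complex.exp (((α * Real.log z : ℝ) : ℂ) + ((π * α : ℝ) : ℂ) * Complex.I) /
      (y + Complex.exp (((α * Real.log z : ℝ) : ℂ) + ((π * α : ℝ) : ℂ) * Complex.I))).im := by
  rw [exp_mk hz, im_frac _ _ _ _ (Real.sin_sq_add_cos_sq (π * α))]
  have hc : 0 < y ^ (1 / α) := Real.rpow_pos_of_pos hy _
  have hcα : (y ^ (1 / α)) ^ α = y := by
    rw [← Real.rpow_mul hy.le, one_div_mul_cancel hα0.ne', Real.rpow_one]
  have hq : 0 < z ^ α := Real.rpow_pos_of_pos hz _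
  rw [lamp_of_pos (by positivity), Real.mul_rpow hz.le (by positivity), Real.inv_rpow hc.le, hcα]
  have hp := Real.pi_pos
  generalize y ^ (1 / α) = c at *
  have h1 := lamp_den_pos (r := z ^ α * y⁻¹) hα0 hα1
  generalize z ^ α = q at *
  have h2 : y ^ 2 + 2 * y * q * Real.cos (π * α) + q ^ 2 =
    y ^ 2 * ((q * y⁻¹) ^ 2 + 2 * (q * y⁻¹) * Real.cos (π * α) + 1) := by
    field_simp; ring
  rw [h2]
  generalize ((q * y⁻¹) ^ 2 + 2 * (q * y⁻¹) * Real.cos (π * α) + 1) = D at *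
  field_simp

lemma lamp_conv {α β : ℝ} (hα0 : 0 < α) (hα1 : α < 1) (hβ0 : 0 < β) (hβ1 : β < 1)
    (hI : IntegrableOn (lampertiDensity β) (Ioi 0)) (z : ℝ) :
    ∫⁻ y, ENNReal.ofReal (lampertiDensity β y) *
      ENNReal.ofReal ((y ^ (1 / α))⁻¹ * lampertiDensity α (z * (y ^ (1 / α))⁻¹)) =
    ENNReal.ofReal (lampertiDensity (α * β) z) := by
  have hp := Real.pi_pos
  have hsupp : ∫⁻ y, ENNReal.ofReal (lampertiDensity β y) *
      ENNReal.ofReal ((y ^ (1 / α))⁻¹ * lampertiDensity α (z * (y ^ (1 / α))⁻¹)) =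
      ∫⁻ y in Ioi 0, ENNReal.ofReal (lampertiDensity β y) *
      ENNReal.ofReal ((y ^ (1 / α))⁻¹ * lampertiDensity α (z * (y ^ (1 / α))⁻¹)) := by
    rw [← lintegral_indicator measurableSet_Ioi]
    congr 1
    funext y
    by_cases hy : 0 < y
    · rw [Set.indicator_of_mem (by exact hy)]
    · rw [Set.indicator_of_notMem (by exact hy), lamp_zero hy]; simp
  rw [hsupp]
  by_cases hz : 0 < z
  swap
  · rw [lamp_zero hz, ENNReal.ofReal_zero]
    rw [setLIntegral_congr_fun (g := fun _ => 0) measurableSet_Ioi]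
    · simp
    · intro y hy
      have hc : 0 < y ^ (1 / α) := Real.rpow_pos_of_pos hy _
      have : ¬ 0 < z * (y ^ (1 / α))⁻¹ := by
        push Not at hz ⊢
        exact mul_nonpos_of_nonpos_of_nonneg hz (by positivity)
      simp only [lamp_zero this]
      simp
  set l : ℂ := ((α * Real.log z : ℝ) : ℂ) + ((π * α : ℝ) : ℂ) * Complex.I with hl
  have him : l.im = π * α := by simp [hl]
  obtain ⟨i1, i2⟩ := integral_lamp_y hβ0 hβ1 (l := l) (by rw [him]; positivity)
    (by rw [him]; nlinarith) hI
  have hk : ∀ y ∈ Ioi (0:ℝ), lampertiDensity β y *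
      ((y ^ (1 / α))⁻¹ * lampertiDensity α (z * (y ^ (1 / α))⁻¹)) =
      1 / (π * z) * (((lampertiDensity β y : ℝ) : ℂ) *
      (Complex.exp l / (y + Complex.exp l))).im := by
    intro y hy
    rw [lamp_kernel hα0 hα1 hz hy, Complex.im_ofReal_mul]
    ring
  have hnn : ∀ y ∈ Ioi (0:ℝ), 0 ≤ 1 / (π * z) * (((lampertiDensity β y : ℝ) : ℂ) *
      (Complex.exp l / (y + Complex.exp l))).im := by
    intro y hy
    rw [← hk y hy]
    have hc : 0 < y ^ (1 / α) := Real.rpow_pos_of_pos hy _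
    exact mul_nonneg (lamp_nonneg hβ0 hβ1 _) (mul_nonneg (by positivity) (lamp_nonneg hα0 hα1 _))
  rw [setLIntegral_congr_fun (g := fun y => ENNReal.ofReal (1 / (π * z) *
    (((lampertiDensity β y : ℝ) : ℂ) * (Complex.exp l / (y + Complex.exp l))).im)) measurableSet_Ioi]
  · rw [← ofReal_integral_eq_lintegral_ofReal, integral_const_mul, lamp_eq_im hz, ← hl, ← i2]
    · congr 2
      exact (Complex.imCLM.integral_comp_comm i1)
    · exact (Complex.imCLM.integrable_comp i1).const_mul _
    · exact (ae_restrict_iff' measurableSet_Ioi).mpr (Filter.Eventually.of_forall hnn)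
  · intro y hy
    simp only
    rw [← ENNReal.ofReal_mul (lamp_nonneg hβ0 hβ1 _), hk y hy]

lemma lamp_ne_zero {γ : ℝ} (h0 : 0 < γ) (h1 : γ < 1) :
    volume.withDensity (fun x => ENNReal.ofReal (lampertiDensity γ x)) ≠ 0 := by
  intro h
  rw [withDensity_eq_zero_iff (lamp_meas γ).ennreal_ofReal.aemeasurable] at h
  have h2 : volume (Ioi (0:ℝ)) = 0 := by
    refine measure_mono_null ?_ h
    intro x hx
    have hp := Real.pi_pos
    have hs : 0 < Real.sin (π * γ) :=
      Real.sin_pos_of_pos_of_lt_pi (by positivity) (by nlinarith)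
    have hd := lamp_den_pos (r := x ^ γ) h0 h1
    have hx0 : 0 < x := hx
    have : 0 < lampertiDensity γ x := by
      rw [lamp_of_pos hx0]; positivity
    simpa using this
  simp at h2

lemma lamp_scale {γ c : ℝ} (hc : 0 < c) (A : Set ℝ) (hA : MeasurableSet A) :
    volume.withDensity (fun x => ENNReal.ofReal (lampertiDensity γ x)) ((fun x => x * c) ⁻¹' A) =
      ∫⁻ z in A, ENNReal.ofReal (c⁻¹ * lampertiDensity γ (z * c⁻¹)) := by
  have hm := (lamp_meas γ).ennreal_ofReal
  have hA' : MeasurableSet ((fun x : ℝ => x * c) ⁻¹' A) := hA.preimage (by fun_prop)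
  have hci : c⁻¹ ≠ 0 := (inv_pos.mpr hc).ne'
  rw [withDensity_apply _ hA', ← lintegral_indicator hA']
  nth_rewrite 1 [← Real.smul_map_volume_mul_right hci]
  rw [lintegral_smul_measure, lintegral_map (hm.indicator hA') (by fun_prop), smul_eq_mul,
    ← lintegral_const_mul' _ _ ENNReal.ofReal_ne_top, ← lintegral_indicator hA]
  congr 1
  funext z
  by_cases hz : z ∈ A
  · rw [Set.indicator_of_mem hz, Set.indicator_of_mem (by simpa [mul_assoc, inv_mul_cancel₀ hc.ne'] using hz),
      abs_of_pos (inv_pos.mpr hc), ENNReal.ofReal_mul (inv_pos.mpr hc).le]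
  · rw [Set.indicator_of_notMem hz, Set.indicator_of_notMem (by simpa [mul_assoc, inv_mul_cancel₀ hc.ne'] using hz),
      mul_zero]

theorem stmt_17 {Ω : Type*} [MeasureSpace Ω] [IsProbabilityMeasure (ℙ : Measure Ω)]
    (α β : ℝ) (hα0 : 0 < α) (hα1 : α < 1) (hβ0 : 0 < β) (hβ1 : β < 1)
    (X Y : Ω → ℝ) (hXY : IndepFun X Y)
    (hX : Measure.map X ℙ = volume.withDensity
        (fun x => ENNReal.ofReal (lampertiDensity α x)))
    (hY : Measure.map Y ℙ = volume.withDensity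
        (fun x => ENNReal.ofReal (lampertiDensity β x))) :
    Measure.map (fun ω => X ω * (Y ω) ^ ((1:ℝ)/α)) ℙ
      = volume.withDensity (fun x => ENNReal.ofReal (lampertiDensity (α * β) x)) := by
  have mX : AEMeasurable X ℙ := by
    by_contra h
    rw [Measure.map_of_not_aemeasurable h] at hX
    exact lamp_ne_zero hα0 hα1 hX.symm
  have mY : AEMeasurable Y ℙ := by
    by_contra h
    rw [Measure.map_of_not_aemeasurable h] at hY
    exact lamp_ne_zero hβ0 hβ1 hY.symm
  have pX := Measure.isProbabilityMeasure_map mX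
  have pY := Measure.isProbabilityMeasure_map mY
  have hI : IntegrableOn (lampertiDensity β) (Ioi 0) := by
    refine Integrable.integrableOn ⟨(lamp_meas β).aestronglyMeasurable, ?_⟩
    rw [hasFiniteIntegral_iff_ofReal (Filter.Eventually.of_forall (lamp_nonneg hβ0 hβ1))]
    rw [← setLIntegral_univ, ← withDensity_apply _ MeasurableSet.univ, ← hY]
    exact measure_lt_top _ _
  have hprod := (indepFun_iff_map_prod_eq_prod_map_map mX mY).mp hXY
  have hg : Measurable (fun p : ℝ × ℝ => p.1 * p.2 ^ ((1:ℝ)/α)) := by fun_prop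
  have hcomp : Measure.map (fun ω => X ω * (Y ω) ^ ((1:ℝ)/α)) ℙ =
      Measure.map (fun p : ℝ × ℝ => p.1 * p.2 ^ ((1:ℝ)/α)) ((Measure.map X ℙ).prod (Measure.map Y ℙ)) := by
    rw [← hprod, AEMeasurable.map_map_of_aemeasurable hg.aemeasurable (mX.prodMk mY)]
    rfl
  rw [hcomp]
  ext A hA
  have hmK : Measurable (fun p : ℝ × ℝ => ENNReal.ofReal (lampertiDensity β p.1) *
      ENNReal.ofReal ((p.1 ^ (1 / α))⁻¹ * lampertiDensity α (p.2 * (p.1 ^ (1 / α))⁻¹))) := by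
    have h1 := lamp_meas α
    have h2 := lamp_meas β
    fun_prop
  rw [Measure.map_apply hg hA, Measure.prod_apply_symm (hg hA), hY,
    lintegral_withDensity_eq_lintegral_mul _ (lamp_meas β).ennreal_ofReal
      (measurable_measure_prodMk_right (hg hA)), withDensity_apply _ hA]
  have hstep : ∀ y : ℝ, ENNReal.ofReal (lampertiDensity β y) *
      (Measure.map X ℙ) ((fun x => (x, y)) ⁻¹' ((fun p : ℝ × ℝ => p.1 * p.2 ^ ((1:ℝ)/α)) ⁻¹' A)) =
      ∫⁻ z in A, ENNReal.ofReal (lampertiDensity β y) *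
      ENNReal.ofReal ((y ^ (1 / α))⁻¹ * lampertiDensity α (z * (y ^ (1 / α))⁻¹)) := by
    intro y
    by_cases hy : 0 < y
    · rw [hX, lintegral_const_mul' _ _ ENNReal.ofReal_ne_top,
        ← lamp_scale (Real.rpow_pos_of_pos hy _) A hA]
      rfl
    · simp [lamp_zero hy]
  simp only [Pi.mul_apply, hstep]
  rw [lintegral_lintegral_swap hmK.aemeasurable]
  refine lintegral_congr fun z => ?_
  exact lamp_conv hα0 hα1 hβ0 hβ1 hI z
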